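/- Let α be irrational with 0 < α < 1 and let (b_i) be a sequence of nonnegative integers with b_i ≤ a_i − 1 for all i, and set β = Σ_{k≥1} b_k D_k. Then 0 ≤ β < 1 and (b_i) is exactly the sequence of Davenport coefficients of β if and only if (b_i) contains no finite block (b_i, b_{i+1}, …, b_j) with i < j equal to (a_i − 1, a_{i+1} − 2, a_{i+2} − 2, …, a_{j−1} − 2, a_j − 1), and no infinite tail (b_i, b_{i+1}, b_{i+2}, …) equal to (a_i − 1, a_{i+1} − 2, a_{i+2} − 2, a_{i+3} − 2, …). -/

import Mathlib

open Filter Finset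

/-- Distance from `x` to the nearest integer. -/
noncomputable def nint (x : ℝ) : ℝ := |x - (round x : ℝ)|

/-- One-sided inhomogeneous approximation constant
`M₊(α,β) = liminf_{q→∞} q‖qα−β‖` over positive integers `q`. -/
noncomputable def Mplus (α β : ℝ) : ℝ :=
  Filter.liminf (fun q : ℕ => (q : ℝ) * nint (q * α - β)) Filter.atTop

/-- Complete quotients of the negative continued fraction: `ncq α i = α_{i+1}`,
so `ncq α 0 = α₁ = α` and `α_{i+1} = a_i - 1/α_i` with `a_i = ⌈1/α_i⌉`. -/
noncomputable def ncq (α : ℝ) : ℕ → ℝ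
  | 0 => α
  | i + 1 => (⌈(ncq α i)⁻¹⌉ : ℝ) - (ncq α i)⁻¹

/-- Partial quotients of the negative continued fraction: `npq α i = a_i = ⌈1/α_i⌉` for `i ≥ 1`. -/
noncomputable def npq (α : ℝ) (i : ℕ) : ℤ := ⌈(ncq α (i - 1))⁻¹⌉

/-- Convergent denominators: `q₀ = 1`, `q₁ = a₁`, `q_{i+2} = a_{i+2} q_{i+1} − q_i`. -/
noncomputable def nq (α : ℝ) : ℕ → ℤ
  | 0 => 1
  | 1 => npq α 1
  | i + 2 => npq α (i + 2) * nq α (i + 1) - nq α i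

/-- Convergent numerators: `p₀ = 0`, `p₁ = 1`, `p_{i+2} = a_{i+2} p_{i+1} − p_i`. -/
noncomputable def np (α : ℝ) : ℕ → ℤ
  | 0 => 0
  | 1 => 1
  | i + 2 => npq α (i + 2) * np α (i + 1) - np α i

/-- `Dk α k = α₁α₂⋯α_k` (with `Dk α 0 = 1`). -/
noncomputable def Dk (α : ℝ) (k : ℕ) : ℝ := ∏ j ∈ Finset.range k, ncq α j

/-- Davenport remainders: `drem α β i = β_{i+1}`, so `drem α β 0 = β₁ = β` and
`β_{i+1} = β_i/α_i − ⌊β_i/α_i⌋`. -/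
noncomputable def drem (α β : ℝ) : ℕ → ℝ
  | 0 => β
  | i + 1 => Int.fract (drem α β i / ncq α i)

/-- Davenport coefficients: `db α β i = b_i = ⌊β_i/α_i⌋` for `i ≥ 1`. -/
noncomputable def db (α β : ℝ) (i : ℕ) : ℤ := ⌊drem α β (i - 1) / ncq α (i - 1)⌋

/-- `Qn α β n = Σ_{k=1}^n b_k q_{k−1}`. -/
noncomputable def Qn (α β : ℝ) (n : ℕ) : ℤ :=
  ∑ k ∈ Finset.Icc 1 n, db α β k * nq α (k - 1)

/-- `Q′_n`. -/
noncomputable def Qn' (α β : ℝ) (n : ℕ) : ℤ :=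
  if Qn α β n < nq α n - nq α (n - 1) then Qn α β n + nq α (n - 1)
  else Qn α β n + nq α (n - 1) - nq α n

/-- `λ_n(β) = Q_n D_n β_{n+1}`. -/
noncomputable def lam (α β : ℝ) (n : ℕ) : ℝ :=
  (Qn α β n : ℝ) * Dk α n * drem α β n

/-- `ρ_n(β)`. -/
noncomputable def rho (α β : ℝ) (n : ℕ) : ℝ :=
  if Qn α β n < nq α n - nq α (n - 1)
  then (Qn' α β n : ℝ) * Dk α n * (1 - drem α β n)
  else (Qn' α β n : ℝ) * Dk α n * (1 - ncq α n - drem α β n)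

/-- Reversed quotients: `ᾱ₀ = 0`, `ᾱ_i = 1/(a_i − ᾱ_{i−1})`. -/
noncomputable def rq (α : ℝ) : ℕ → ℝ
  | 0 => 0
  | i + 1 => ((npq α (i + 1) : ℝ) - rq α i)⁻¹

theorem ncq_irrational_mem {α : ℝ} (hirr : Irrational α) (h0 : 0 < α) (h1 : α < 1) (i : ℕ) :
    Irrational (ncq α i) ∧ 0 < ncq α i ∧ ncq α i < 1 := by
  induction i with
  | zero => exact ⟨hirr, h0, h1⟩
  | succ i ih =>
    have hirr' : Irrational (ncq α (i + 1)) := ih.1.inv.intCast_sub _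
    have hle := Int.le_ceil (ncq α i)⁻¹
    have hlt := Int.ceil_lt_add_one (ncq α i)⁻¹
    refine ⟨hirr', lt_of_le_of_ne ?_ hirr'.ne_zero.symm, ?_⟩ <;> simp only [ncq] <;> linarith

theorem Dk_succ (α : ℝ) (i : ℕ) : Dk α (i + 1) = Dk α i * ncq α i :=
  Finset.prod_range_succ _ _

theorem Dk_pos {α : ℝ} (hirr : Irrational α) (h0 : 0 < α) (h1 : α < 1) (i : ℕ) : 0 < Dk α i :=
  Finset.prod_pos fun j _ => (ncq_irrational_mem hirr h0 h1 j).2.1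

theorem Dk_succ_lt {α : ℝ} (hirr : Irrational α) (h0 : 0 < α) (h1 : α < 1) (i : ℕ) :
    Dk α (i + 1) < Dk α i := by
  rw [Dk_succ]
  exact mul_lt_of_lt_one_right (Dk_pos hirr h0 h1 i) (ncq_irrational_mem hirr h0 h1 i).2.2

theorem Dk_eq {α : ℝ} (hirr : Irrational α) (h0 : 0 < α) (h1 : α < 1) (i : ℕ) :
    Dk α i = npq α (i + 1) * Dk α (i + 1) - Dk α (i + 2) := by
  have hne := (ncq_irrational_mem hirr h0 h1 i).2.1.ne'
  have hq : ncq α (i + 1) = npq α (i + 1) - (ncq α i)⁻¹ := rfl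
  rw [Dk_succ α (i + 1), Dk_succ α i, hq]
  field_simp
  ring

/-- No block `(a_{i+1} - 2, …, a_{j-1} - 2, a_j - 1)` starts right after position `i`. -/
def NoHeavyBlock (a b : ℕ → ℤ) (i : ℕ) : Prop :=
  ∀ j, i < j → (∀ k, i < k → k < j → b k = a k - 2) → b j ≠ a j - 1

theorem NoHeavyBlock.le_sub_two {a b : ℕ → ℤ} {i : ℕ} (h : NoHeavyBlock a b i)
    (hb : b (i + 1) ≤ a (i + 1) - 1) : b (i + 1) ≤ a (i + 1) - 2 := by
  have := h (i + 1) (by omega) (by intros; omega)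
  omega

theorem NoHeavyBlock.succ {a b : ℕ → ℤ} {i : ℕ} (h : NoHeavyBlock a b i)
    (hb : b (i + 1) = a (i + 1) - 2) : NoHeavyBlock a b (i + 1) := by
  intro j hj hk
  refine h j (by omega) fun k hik hkj => ?_
  rcases Nat.lt_or_ge (i + 1) k with hlt | hge
  · exact hk k hlt hkj
  · obtain rfl : k = i + 1 := by omega
    exact hb

section Expansion

variable {d : ℕ → ℝ} {a b : ℕ → ℤ}

/-- Bounds for the `n`-term sums following position `i`. -/
theorem sum_le_of_no_block (hpos : ∀ i, 0 < d i) (hlt : ∀ i, d (i + 1) < d i)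
    (hrec : ∀ i, d i = a (i + 1) * d (i + 1) - d (i + 2))
    (hb : ∀ i, 1 ≤ i → b i ≤ a i - 1)
    (hblock : ∀ i, 1 ≤ i → b i = a i - 1 → NoHeavyBlock a b i) (n : ℕ) :
    ∀ i, (∑ k ∈ range n, (b (i + 1 + k) : ℝ) * d (i + 1 + k) ≤ d i) ∧
      (NoHeavyBlock a b i →
        ∑ k ∈ range n, (b (i + 1 + k) : ℝ) * d (i + 1 + k) ≤ d i - d (i + 1)) := by
  induction n with
  | zero => exact fun i => ⟨by simpa using (hpos i).le, fun _ => by simpa using (hlt i).le⟩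
  | succ n ih =>
    intro i
    have hsum : ∑ k ∈ range (n + 1), (b (i + 1 + k) : ℝ) * d (i + 1 + k) =
        b (i + 1) * d (i + 1) + ∑ k ∈ range n, (b (i + 1 + 1 + k) : ℝ) * d (i + 1 + 1 + k) := by
      rw [Finset.sum_range_succ', add_comm]
      simp [add_comm, add_left_comm]
    obtain ⟨ih₁, ih₂⟩ := ih (i + 1)
    have hp := hpos (i + 1)
    have hl := hlt (i + 1)
    have hr := hrec i
    have hbi := hb (i + 1) (by omega)
    rw [hsum]
    constructor
    · rcases eq_or_lt_of_le hbi with h | h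
      · have := ih₂ (hblock _ (by omega) h)
        rw [h]
        push_cast
        linarith
      · have h' : (b (i + 1) : ℝ) ≤ a (i + 1) - 2 := by
          exact_mod_cast (by omega : b (i + 1) ≤ a (i + 1) - 2)
        have := mul_le_mul_of_nonneg_right h' hp.le
        linarith
    · intro hQ
      rcases eq_or_lt_of_le (hQ.le_sub_two hbi) with h | h
      · have := ih₂ (hQ.succ h)
        rw [h]
        push_cast
        linarith
      · have h' : (b (i + 1) : ℝ) ≤ a (i + 1) - 3 := by
          exact_mod_cast (by omega : b (i + 1) ≤ a (i + 1) - 3)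
        have := mul_le_mul_of_nonneg_right h' hp.le
        linarith

theorem remainder_lt_sub_of_ne {R : ℕ → ℝ} (hpos : ∀ i, 0 < d i) (hlt : ∀ i, d (i + 1) < d i)
    (hrec : ∀ i, d i = a (i + 1) * d (i + 1) - d (i + 2))
    (hb : ∀ i, 1 ≤ i → b i ≤ a i - 1)
    (hR : ∀ i, R i = b (i + 1) * d (i + 1) + R (i + 1)) (hRle : ∀ i, R i ≤ d i) (m : ℕ) :
    ∀ i, NoHeavyBlock a b i → b (i + 1 + m) ≠ a (i + 1 + m) - 2 → R i < d i - d (i + 1) := by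
  induction m with
  | zero =>
    intro i hQ hne
    have h := hQ.le_sub_two (hb _ (by omega))
    have h' : (b (i + 1) : ℝ) ≤ a (i + 1) - 3 := by
      rw [add_zero] at hne
      exact_mod_cast (by omega : b (i + 1) ≤ a (i + 1) - 3)
    have := mul_le_mul_of_nonneg_right h' (hpos (i + 1)).le
    linarith [hR i, hrec i, hRle (i + 1), hlt (i + 1), hpos (i + 2)]
  | succ m ih =>
    intro i hQ hne
    rcases eq_or_lt_of_le (hQ.le_sub_two (hb _ (by omega))) with h | h
    · have := ih (i + 1) (hQ.succ h) (by rwa [show i + 1 + 1 + m = i + 1 + (m + 1) by omega])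
      rw [hR i, h]
      push_cast
      linarith [hrec i]
    · have h' : (b (i + 1) : ℝ) ≤ a (i + 1) - 3 := by
        exact_mod_cast (by omega : b (i + 1) ≤ a (i + 1) - 3)
      have := mul_le_mul_of_nonneg_right h' (hpos (i + 1)).le
      linarith [hR i, hrec i, hRle (i + 1), hlt (i + 1), hpos (i + 2)]

/-- A sequence without forbidden blocks or tails has convergent expansion, whose remainders
stay in `[0, d i)`. -/
theorem exists_remainder_of_no_block (hpos : ∀ i, 0 < d i) (hlt : ∀ i, d (i + 1) < d i)
    (hrec : ∀ i, d i = a (i + 1) * d (i + 1) - d (i + 2))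
    (hb : ∀ i, 1 ≤ i → 0 ≤ b i ∧ b i ≤ a i - 1)
    (hblock : ∀ i, 1 ≤ i → b i = a i - 1 → NoHeavyBlock a b i)
    (htail : ∀ i, 1 ≤ i → b i = a i - 1 → ∃ k, i < k ∧ b k ≠ a k - 2) :
    ∃ R : ℕ → ℝ, R 0 = ∑' k : ℕ, (b (k + 1) : ℝ) * d (k + 1) ∧
      (∀ i, R i = b (i + 1) * d (i + 1) + R (i + 1)) ∧ ∀ i, 0 ≤ R i ∧ R i < d i := by
  have hb' := fun i hi => (hb i hi).2
  have hnn : ∀ i k : ℕ, 0 ≤ (b (i + 1 + k) : ℝ) * d (i + 1 + k) := fun i k =>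
    mul_nonneg (by exact_mod_cast (hb _ (by omega)).1) (hpos _).le
  have hsum := fun n i => (sum_le_of_no_block hpos hlt hrec hb' hblock n i).1
  have hsummable : ∀ i, Summable fun k => (b (i + 1 + k) : ℝ) * d (i + 1 + k) := fun i =>
    summable_of_sum_range_le (hnn i) fun n => hsum n i
  have hR : ∀ i, ∑' k, (b (i + 1 + k) : ℝ) * d (i + 1 + k) =
      b (i + 1) * d (i + 1) + ∑' k, (b (i + 1 + 1 + k) : ℝ) * d (i + 1 + 1 + k) := by
    intro i
    rw [(hsummable i).tsum_eq_zero_add]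
    simp [add_comm, add_left_comm]
  have hRle : ∀ i, ∑' k, (b (i + 1 + k) : ℝ) * d (i + 1 + k) ≤ d i := fun i =>
    Real.tsum_le_of_sum_range_le (hnn i) fun n => hsum n i
  refine ⟨fun i => ∑' k, (b (i + 1 + k) : ℝ) * d (i + 1 + k), by simp [add_comm], hR,
    fun i => ⟨tsum_nonneg (hnn i), ?_⟩⟩
  rcases eq_or_lt_of_le (hb' (i + 1) (by omega)) with h | h
  · obtain ⟨k, hk, hne⟩ := htail _ (by omega) h
    obtain ⟨m, rfl⟩ := Nat.exists_eq_add_of_le (Nat.succ_le_of_lt hk)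
    have := remainder_lt_sub_of_ne hpos hlt hrec hb' hR hRle m (i + 1)
      (hblock _ (by omega) h) hne
    beta_reduce
    rw [hR i, h]
    push_cast
    linarith [hrec i]
  · have h' : (b (i + 1) : ℝ) ≤ a (i + 1) - 2 := by
      exact_mod_cast (by omega : b (i + 1) ≤ a (i + 1) - 2)
    have := mul_le_mul_of_nonneg_right h' (hpos (i + 1)).le
    linarith [hR i, hrec i, hRle (i + 1), hlt (i + 1)]

/-- After a digit `a_i - 1`, the gap `d n - d (n + 1) - R n` is constant and positive along
digits `a_n - 2`. -/
theorem gap_eq_of_digits {R : ℕ → ℝ}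
    (hrec : ∀ i, d i = a (i + 1) * d (i + 1) - d (i + 2))
    (hR : ∀ i, R i = b (i + 1) * d (i + 1) + R (i + 1)) {i : ℕ} (m : ℕ)
    (hk : ∀ k, i < k → k ≤ i + m → b k = a k - 2) :
    d (i + m) - d (i + m + 1) - R (i + m) = d i - d (i + 1) - R i := by
  induction m with
  | zero => rfl
  | succ m ih =>
    rw [← ih fun k h₁ h₂ => hk k h₁ (by omega)]
    have h₁ := hR (i + m)
    rw [hk (i + m + 1) (by omega) (by omega)] at h₁
    have h₂ := hrec (i + m)
    push_cast at h₁
    rw [← add_assoc i m 1]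
    linarith

theorem remainder_lt_of_digit {R : ℕ → ℝ}
    (hrec : ∀ i, d i = a (i + 1) * d (i + 1) - d (i + 2))
    (hR : ∀ i, R i = b (i + 1) * d (i + 1) + R (i + 1)) (hRlt : ∀ i, R i < d i) {i : ℕ}
    (hi : 1 ≤ i) (h : b i = a i - 1) : R i < d i - d (i + 1) := by
  obtain ⟨i, rfl⟩ := Nat.exists_eq_add_of_le' hi
  have h₁ := hR i
  rw [h] at h₁
  push_cast at h₁
  linarith [hrec i, hRlt i]

theorem noHeavyBlock_of_remainder {R : ℕ → ℝ} (hpos : ∀ i, 0 < d i)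
    (hrec : ∀ i, d i = a (i + 1) * d (i + 1) - d (i + 2))
    (hR : ∀ i, R i = b (i + 1) * d (i + 1) + R (i + 1)) (hR0 : ∀ i, 0 ≤ R i)
    (hRlt : ∀ i, R i < d i) {i : ℕ} (hi : 1 ≤ i) (h : b i = a i - 1) : NoHeavyBlock a b i := by
  intro j hj hk hbj
  have hlt := remainder_lt_of_digit hrec hR hRlt hi h
  obtain ⟨m, rfl⟩ := Nat.exists_eq_add_of_le (Nat.succ_le_of_lt hj)
  rw [show i.succ + m = i + m + 1 by omega] at hbj hk
  have hgap := gap_eq_of_digits hrec hR m fun k h₁ h₂ => hk k h₁ (by omega)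
  have h₁ := hR (i + m)
  rw [hbj] at h₁
  push_cast at h₁
  linarith [hrec (i + m), hR0 (i + m + 1), hpos (i + m + 2)]

theorem exists_ne_of_remainder {R : ℕ → ℝ} (hpos : ∀ i, 0 < d i) (hlt : ∀ i, d (i + 1) < d i)
    (hrec : ∀ i, d i = a (i + 1) * d (i + 1) - d (i + 2))
    (hR : ∀ i, R i = b (i + 1) * d (i + 1) + R (i + 1)) (hR0 : ∀ i, 0 ≤ R i)
    (hRlt : ∀ i, R i < d i) {i : ℕ} (hi : 1 ≤ i) (h : b i = a i - 1) :
    ∃ k, i < k ∧ b k ≠ a k - 2 := by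
  by_contra! hk
  have hlt' := remainder_lt_of_digit hrec hR hRlt hi h
  have hlim := tendsto_atTop_ciInf (antitone_nat_of_succ_le fun n => (hlt n).le)
    ⟨0, by rintro _ ⟨n, rfl⟩; exact (hpos n).le⟩
  have hdiff := hlim.sub (hlim.comp (tendsto_add_atTop_nat 1))
  rw [sub_self] at hdiff
  obtain ⟨N, hN⟩ := (hdiff.eventually_lt_const (sub_pos.2 hlt')).exists_forall_of_atTop
  have hgap := gap_eq_of_digits hrec hR N fun k h₁ _ => hk k h₁
  have := hN (i + N) (by omega)
  simp only [Function.comp_apply] at this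
  linarith [hR0 (i + N)]

end Expansion

theorem drem_mem {α β : ℝ} (h0 : 0 ≤ β) (h1 : β < 1) (i : ℕ) :
    0 ≤ drem α β i ∧ drem α β i < 1 := by
  cases i with
  | zero => exact ⟨h0, h1⟩
  | succ i => exact ⟨Int.fract_nonneg _, Int.fract_lt_one _⟩

theorem drem_mul_Dk {α : ℝ} (hirr : Irrational α) (h0 : 0 < α) (h1 : α < 1) (β : ℝ) (i : ℕ) :
    drem α β i * Dk α i =
      db α β (i + 1) * Dk α (i + 1) + drem α β (i + 1) * Dk α (i + 1) := by
  have hne := (ncq_irrational_mem hirr h0 h1 i).2.1.ne'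
  rw [← add_mul, Dk_succ]
  simp only [db, drem, Nat.add_sub_cancel, Int.floor_add_fract]
  field_simp

theorem db_eq_of_remainder {α : ℝ} (hirr : Irrational α) (h0 : 0 < α) (h1 : α < 1)
    {b : ℕ → ℤ} {R : ℕ → ℝ} (hR : ∀ i, R i = b (i + 1) * Dk α (i + 1) + R (i + 1))
    (hmem : ∀ i, 0 ≤ R i ∧ R i < Dk α i) (i : ℕ) :
    db α (R 0) (i + 1) = b (i + 1) := by
  have hpos := Dk_pos hirr h0 h1
  have hquot : ∀ i, R i / Dk α i / ncq α i = b (i + 1) + R (i + 1) / Dk α (i + 1) := by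
    intro i
    rw [div_div, ← Dk_succ, hR i, add_div, mul_div_cancel_right₀ _ (hpos _).ne']
  have hfloor : ∀ i, ⌊R (i + 1) / Dk α (i + 1)⌋ = 0 := fun i =>
    Int.floor_eq_zero_iff.2 ⟨div_nonneg (hmem _).1 (hpos _).le,
      (div_lt_one (hpos _)).2 (hmem _).2⟩
  have hdrem : ∀ i, drem α (R 0) i = R i / Dk α i := by
    intro i
    induction i with
    | zero => simp [drem, Dk]
    | succ i ih =>
      rw [drem, ih, hquot, Int.fract_intCast_add, Int.fract, hfloor]
      simp
  simp only [db, Nat.add_sub_cancel]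
  rw [hdrem, hquot, Int.floor_intCast_add, hfloor, add_zero]

/-- For irrational `0 < α < 1` and a sequence `(b_i)_{i≥1}` of nonnegative
integers with `b_i ≤ a_i − 1`, setting `β = Σ_{k≥1} b_k D_k`, we have: `0 ≤ β < 1` and
`(b_i)` is exactly the sequence of Davenport coefficients of `β` iff `(b_i)` contains no
finite block `(b_i, …, b_j)`, `i < j`, equal to `(a_i−1, a_{i+1}−2, …, a_{j−1}−2, a_j−1)`,
and no infinite tail `(b_i, b_{i+1}, …)` equal to `(a_i−1, a_{i+1}−2, a_{i+2}−2, …)`. -/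
theorem stmt8 (α : ℝ) (hirr : Irrational α) (h0 : 0 < α) (h1 : α < 1)
    (b : ℕ → ℤ) (hb : ∀ i : ℕ, 1 ≤ i → 0 ≤ b i ∧ b i ≤ npq α i - 1)
    (β : ℝ) (hβ : β = ∑' k : ℕ, (b (k + 1) : ℝ) * Dk α (k + 1)) :
    (0 ≤ β ∧ β < 1 ∧ ∀ i : ℕ, 1 ≤ i → db α β i = b i) ↔
      ((∀ i j : ℕ, 1 ≤ i → i < j →
          ¬ (b i = npq α i - 1 ∧ (∀ k : ℕ, i < k → k < j → b k = npq α k - 2) ∧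
              b j = npq α j - 1)) ∧
        (∀ i : ℕ, 1 ≤ i →
          ¬ (b i = npq α i - 1 ∧ ∀ k : ℕ, i < k → b k = npq α k - 2))) := by
  have hpos := Dk_pos hirr h0 h1
  have hlt := Dk_succ_lt hirr h0 h1
  have hrec := Dk_eq hirr h0 h1
  constructor
  · rintro ⟨hβ0, hβ1, hdb⟩
    have hR : ∀ i, drem α β i * Dk α i =
        b (i + 1) * Dk α (i + 1) + drem α β (i + 1) * Dk α (i + 1) := fun i => by
      rw [← hdb (i + 1) (by omega)]
      exact drem_mul_Dk hirr h0 h1 β i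
    have hR0 : ∀ i, 0 ≤ drem α β i * Dk α i := fun i =>
      mul_nonneg (drem_mem hβ0 hβ1 i).1 (hpos i).le
    have hRlt : ∀ i, drem α β i * Dk α i < Dk α i := fun i =>
      mul_lt_of_lt_one_left (hpos i) (drem_mem hβ0 hβ1 i).2
    refine ⟨fun i j hi hij ⟨h₁, h₂, h₃⟩ => ?_, fun i hi ⟨h₁, h₂⟩ => ?_⟩
    · exact noHeavyBlock_of_remainder (R := fun i => drem α β i * Dk α i) hpos hrec hR hR0 hRlt
        hi h₁ j hij h₂ h₃
    · obtain ⟨k, hk, hne⟩ := exists_ne_of_remainder (R := fun i => drem α β i * Dk α i)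
        hpos hlt hrec hR hR0 hRlt hi h₁
      exact hne (h₂ k hk)
  · rintro ⟨hblock, htail⟩
    obtain ⟨R, hRβ, hR, hmem⟩ := exists_remainder_of_no_block hpos hlt hrec hb
      (fun i hi h j hij hk hj => hblock i j hi hij ⟨h, hk, hj⟩)
      (fun i hi h => by
        by_contra! hk
        exact htail i hi ⟨h, hk⟩)
    rw [← hβ] at hRβ
    subst hRβ
    refine ⟨(hmem 0).1, by simpa [Dk] using (hmem 0).2, fun i hi => ?_⟩
    obtain ⟨i, rfl⟩ := Nat.exists_eq_add_of_le' hi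
    exact db_eq_of_remainder hirr h0 h1 hR hmem i
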